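/- If φ : X → X is a boundary function, then the set σ(φ) = {(x,y) ∈ P : x ≺ φ(y)} is an ideal set: it is an open subset of P, and (w,x) ∈ P, (x,y) ∈ σ(φ) and (y,z) ∈ P imply (w,z) ∈ σ(φ). -/

import Mathlib

open Set Topology

/-- A point has a gap below if it has an immediate predecessor. -/
def HasGapBelow {X : Type*} [Preorder X] (x : X) : Prop := ∃ p, p ⋖ x

/-- A point has a gap above if it has an immediate successor. -/
def HasGapAbove {X : Type*} [Preorder X] (x : X) : Prop := ∃ q, x ⋖ q

open Classical in
/-- The immediate predecessor of `x` when it exists; `x` itself otherwise. -/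
noncomputable def predOf {X : Type*} [Preorder X] (x : X) : X :=
  if h : ∃ p, p ⋖ x then h.choose else x

open Classical in
/-- The immediate successor of `x` when it exists; `x` itself otherwise. -/
noncomputable def succOf {X : Type*} [Preorder X] (x : X) : X :=
  if h : ∃ q, x ⋖ q then h.choose else x

/-- The setting: `X` a linearly ordered topological space, `G ⊆ X × X` an
equivalence relation carrying its own topology `tG` (finer than the subspace
topology, i.e. the inclusion is continuous) for which both coordinate
projections are local homeomorphisms, each orbit countable and dense, and
`P ⊆ G` an open transitive subset which on `G` coincides with the order. -/
structure BFSetting (X : Type*) [LinearOrder X] [TopologicalSpace X] where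
  G : Set (X × X)
  tG : TopologicalSpace G
  G_refl : ∀ x : X, (x, x) ∈ G
  G_symm : ∀ {x y : X}, (x, y) ∈ G → (y, x) ∈ G
  G_trans : ∀ {x y z : X}, (x, y) ∈ G → (y, z) ∈ G → (x, z) ∈ G
  incl_continuous : @Continuous G (X × X) tG _ Subtype.val
  pi1_localHomeomorph : @IsLocalHomeomorph G X tG _ (fun g => (g : X × X).1)
  pi2_localHomeomorph : @IsLocalHomeomorph G X tG _ (fun g => (g : X × X).2)
  orbit_countable : ∀ y : X, {x : X | (x, y) ∈ G}.Countable
  orbit_dense : ∀ y : X, Dense {x : X | (x, y) ∈ G}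
  P : Set (X × X)
  P_subset : P ⊆ G
  P_open : @IsOpen G tG (Subtype.val ⁻¹' P)
  P_trans : ∀ {x y z : X}, (x, y) ∈ P → (y, z) ∈ P → (x, z) ∈ P
  P_iff_le : ∀ {x y : X}, (x, y) ∈ G → ((x, y) ∈ P ↔ x ≤ y)

namespace BFSetting

variable {X : Type*} [LinearOrder X] [TopologicalSpace X]

/-- `N` is an open subset of `G` (in the topology of `G`). -/
def OpenInG (S : BFSetting X) (N : Set (X × X)) : Prop :=
  N ⊆ S.G ∧ @IsOpen S.G S.tG (Subtype.val ⁻¹' N)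

/-- A `G`-set: an open subset of `G` on which both projections are injective. -/
def GSet (S : BFSetting X) (N : Set (X × X)) : Prop :=
  S.OpenInG N ∧ Set.InjOn Prod.fst N ∧ Set.InjOn Prod.snd N

/-- An ideal set: an open subset of `P` absorbing multiplication by `P` on both sides. -/
def IdealSet (S : BFSetting X) (σ : Set (X × X)) : Prop :=
  σ ⊆ S.P ∧ @IsOpen S.G S.tG (Subtype.val ⁻¹' σ) ∧
    ∀ w x y z : X, (w, x) ∈ S.P → (x, y) ∈ σ → (y, z) ∈ S.P → (w, z) ∈ σ

/-- `φ` is the boundary function of `σ`: `φ y` is the least upper bound of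
`{x ∈ orb_y : (x, y) ∈ σ}` (for the empty set this forces `φ y` to be the
least element of `X`). -/
def IsBdryFnOf (S : BFSetting X) (σ : Set (X × X)) (φ : X → X) : Prop :=
  ∀ y : X, IsLUB {x : X | (x, y) ∈ S.G ∧ (x, y) ∈ σ} (φ y)

/-- The abstract axioms for a boundary function. -/
def BoundaryFunction (S : BFSetting X) (φ : X → X) : Prop :=
  (∀ y, φ y ≤ y) ∧
  (∀ y, HasGapBelow (φ y) →
    (φ y, y) ∈ S.P ∧ HasGapBelow y ∧ (∀ z, y < z → φ y < φ z) ∧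
    ∃ N : Set (X × X), S.GSet N ∧ (φ y, y) ∈ N ∧ ∀ s t : X, (s, t) ∈ N → s ≤ φ t) ∧
  (∀ y z, y < z → φ y ≤ φ z) ∧
  (∀ y, ¬ HasGapBelow y → IsLUB (φ '' {t | t < y}) (φ y))

/-- `σ(φ)`. -/
def sigmaOpen (S : BFSetting X) (φ : X → X) : Set (X × X) :=
  {p ∈ S.P | p.1 < φ p.2}

/-- `η(φ)`. -/
def eta (S : BFSetting X) (φ : X → X) : Set (X × X) :=
  {p ∈ S.P | p.1 ≤ φ p.2}

/-- `σ[φ]`. -/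
def sigmaClosed (S : BFSetting X) (φ : X → X) : Set (X × X) :=
  {p ∈ S.P | ∃ N : Set (X × X), S.OpenInG N ∧ p ∈ N ∧ N ⊆ S.eta φ}

/-- `L_φ`: the part of the graph of `φ` (at points with a gap below) lying in `σ[φ]`. -/
def Lset (S : BFSetting X) (φ : X → X) : Set (X × X) :=
  {p : X × X | ∃ y : X, p = (φ y, y) ∧ HasGapBelow (φ y)} ∩ S.sigmaClosed φ

/-- A point of modification for `φ`. -/
def ModPoint (S : BFSetting X) (φ : X → X) (y : X) : Prop :=
  HasGapBelow y ∧ HasGapAbove (φ y) ∧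
  ∃ N : Set (X × X), S.GSet N ∧ N ⊆ S.P ∧ (succOf (φ y), y) ∈ N ∧
    ∀ s t : X, (s, t) ∈ N →
      (¬ HasGapAbove (φ t) → s ≤ φ t) ∧ (HasGapAbove (φ t) → s ≤ succOf (φ t))

open Classical in
/-- `φ⁺`. -/
noncomputable def bPlus (S : BFSetting X) (φ : X → X) : X → X :=
  fun y => if S.ModPoint φ y then succOf (φ y) else φ y

/-- A meet irreducible boundary function. -/
def MeetIrred (S : BFSetting X) (φ : X → X) : Prop :=
  S.BoundaryFunction φ ∧
  ∀ ψ₁ ψ₂ : X → X, S.BoundaryFunction ψ₁ → S.BoundaryFunction ψ₂ →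
    (∀ y, φ y = min (ψ₁ y) (ψ₂ y)) → φ = ψ₁ ∨ φ = ψ₂

/-- A join irreducible boundary function. -/
def JoinIrred (S : BFSetting X) (φ : X → X) : Prop :=
  S.BoundaryFunction φ ∧
  ∀ ψ₁ ψ₂ : X → X, S.BoundaryFunction ψ₁ → S.BoundaryFunction ψ₂ →
    (∀ y, φ y = max (ψ₁ y) (ψ₂ y)) → φ = ψ₁ ∨ φ = ψ₂

/-- A join irreducible ideal set. -/
def JoinIrredSet (S : BFSetting X) (σ : Set (X × X)) : Prop :=
  S.IdealSet σ ∧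
  ∀ σ₁ σ₂ : Set (X × X), S.IdealSet σ₁ → S.IdealSet σ₂ →
    σ = σ₁ ∪ σ₂ → σ = σ₁ ∨ σ = σ₂

end BFSetting

/-- `φ⁻`. -/
noncomputable def bMinus {X : Type*} [Preorder X] (φ : X → X) : X → X :=
  fun y => predOf (φ y)

variable {X : Type*} [LinearOrder X] [TopologicalSpace X] [OrderTopology X]
  [CompactSpace X] [T2Space X] [Nonempty X]

open BFSetting

/-- A boundary function is monotone. -/
theorem BFSetting.BoundaryFunction.monotone {X : Type*} [LinearOrder X] [TopologicalSpace X]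
    {S : BFSetting X} {φ : X → X} (hφ : S.BoundaryFunction φ) : Monotone φ := by
  intro y z hyz
  rcases hyz.eq_or_lt with rfl | h
  · exact le_rfl
  · exact hφ.2.2.1 y z h

/-- If `x < φ y`, then some `c > x` bounds `φ` from below on an open ray containing `y`. -/
theorem BFSetting.BoundaryFunction.exists_lt_forall_le {X : Type*} [LinearOrder X]
    [TopologicalSpace X] {S : BFSetting X} {φ : X → X} (hφ : S.BoundaryFunction φ) {x y : X}
    (h : x < φ y) : ∃ u c, u < y ∧ x < c ∧ ∀ t, u < t → c ≤ φ t := by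
  by_cases hy : HasGapBelow y
  · obtain ⟨p, hp⟩ := hy
    exact ⟨p, φ y, hp.lt, h, fun t ht => hφ.monotone (hp.ge_of_gt ht)⟩
  · obtain ⟨_, ⟨t₀, ht₀, rfl⟩, hx⟩ := (lt_isLUB_iff (hφ.2.2.2 y hy)).1 h
    exact ⟨t₀, φ t₀, ht₀, hx, fun t ht => hφ.monotone ht.le⟩

/-- Proposition 2: `σ(φ)` is an ideal set. -/
theorem stmt_1 (S : BFSetting X) (φ : X → X) (hφ : S.BoundaryFunction φ) :
    S.IdealSet (S.sigmaOpen φ) := by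
  refine ⟨fun p hp => hp.1, ?_, ?_⟩
  · let _ : TopologicalSpace S.G := S.tG
    refine isOpen_iff_mem_nhds.2 ?_
    rintro ⟨⟨x, y⟩, hG⟩ ⟨hP, hlt⟩
    obtain ⟨u, c, hu, hc, hle⟩ := hφ.exists_lt_forall_le hlt
    have hbox : IsOpen (Subtype.val ⁻¹' (Iio c ×ˢ Ioi u) : Set S.G) :=
      (isOpen_Iio.prod isOpen_Ioi).preimage S.incl_continuous
    filter_upwards [S.P_open.mem_nhds hP, hbox.mem_nhds ⟨hc, hu⟩] with g hgP hg
    exact ⟨hgP, lt_of_lt_of_le hg.1 (hle _ hg.2)⟩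
  · rintro w x y z hwx ⟨hxy, hlt⟩ hyz
    have hw : w ≤ x := (S.P_iff_le (S.P_subset hwx)).1 hwx
    have hy : y ≤ z := (S.P_iff_le (S.P_subset hyz)).1 hyz
    exact ⟨S.P_trans (S.P_trans hwx hxy) hyz,
      hw.trans_lt (lt_of_lt_of_le hlt (hφ.monotone hy))⟩
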